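/- arXiv:1706.06358 — 11 statements merged into one kernel-verified Lean document; each statement's English description precedes it below -/
import Mathlib

section
/- Let f : (0,1) → ℝ be a strictly increasing homeomorphism (continuous, strictly increasing, bijective onto ℝ) satisfying f(1−a) = −f(a) for every a ∈ (0,1). Then the function J defined by J(a,b) = f⁻¹(f(a) − f(b)) for a, b ∈ (0,1) is an involutive Jamesian function; that is, J maps (0,1) × (0,1) into (0,1), J(a, J(a,b)) = b for all a, b ∈ (0,1), J(a,b) + J(b,a) = 1 for all a, b ∈ (0,1), and for each fixed b₀ ∈ (0,1) the map a ↦ J(a, b₀) is strictly increasing. -/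
open Set

/-- If `f : (0,1) → ℝ` is a strictly increasing homeomorphism
(continuous, strictly increasing, bijective onto ℝ, with inverse `g`)
satisfying `f (1 - a) = - f a`, then `J a b = f⁻¹ (f a - f b)` is an
involutive Jamesian function. -/
theorem stmt_0 (f g : ℝ → ℝ) (J : ℝ → ℝ → ℝ)
    (hf_cont : ContinuousOn f (Ioo 0 1))
    (hf_mono : StrictMonoOn f (Ioo 0 1))
    (hg_mem : ∀ y : ℝ, g y ∈ Ioo (0:ℝ) 1)
    (hgf : ∀ x ∈ Ioo (0:ℝ) 1, g (f x) = x)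
    (hfg : ∀ y : ℝ, f (g y) = y)
    (hsym : ∀ a ∈ Ioo (0:ℝ) 1, f (1 - a) = - f a)
    (hJ : ∀ a b : ℝ, J a b = g (f a - f b)) :
    (∀ a ∈ Ioo (0:ℝ) 1, ∀ b ∈ Ioo (0:ℝ) 1, J a b ∈ Ioo (0:ℝ) 1) ∧
    (∀ a ∈ Ioo (0:ℝ) 1, ∀ b ∈ Ioo (0:ℝ) 1, J a (J a b) = b) ∧
    (∀ a ∈ Ioo (0:ℝ) 1, ∀ b ∈ Ioo (0:ℝ) 1, J a b + J b a = 1) ∧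
    (∀ b₀ ∈ Ioo (0:ℝ) 1, StrictMonoOn (fun a => J a b₀) (Ioo 0 1)) := by
  refine ⟨fun a _ b _ => hJ a b ▸ hg_mem _, fun a _ b hb => ?_, fun a _ b _ => ?_,
    fun b₀ _ x hx y hy hxy => ?_⟩
  · rw [hJ, hJ, hfg, sub_sub_cancel, hgf b hb]
  · have hmem : 1 - g (f a - f b) ∈ Ioo (0:ℝ) 1 := by
      obtain ⟨h0, h1⟩ := hg_mem (f a - f b)
      constructor <;> linarith
    have hneg : g (f b - f a) = 1 - g (f a - f b) := by
      rw [← hgf _ hmem, hsym _ (hg_mem _), hfg, neg_sub]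
    rw [hJ, hJ, hneg, add_sub_cancel]
  · simp only [hJ]
    rw [← hf_mono.lt_iff_lt (hg_mem _) (hg_mem _), hfg, hfg]
    exact sub_lt_sub_right (hf_mono hx hy hxy) _
end

section
/- Let J be an involutive Jamesian function. Then J(a,b) = J(1−b, 1−a) for every a, b ∈ (0,1). -/
open Set

/-- `J` is an involutive Jamesian function on `(0,1)`: it maps
`(0,1) x (0,1)` into `(0,1)`, satisfies the involutive property
`J a (J a b) = b`, satisfies `J a b + J b a = 1`, and for each fixed
`b0 in (0,1)` the map `a => J a b0` is strictly increasing. -/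
def IsJamesian (J : ℝ → ℝ → ℝ) : Prop :=
  (∀ a ∈ Set.Ioo (0:ℝ) 1, ∀ b ∈ Set.Ioo (0:ℝ) 1, J a b ∈ Set.Ioo (0:ℝ) 1) ∧
  (∀ a ∈ Set.Ioo (0:ℝ) 1, ∀ b ∈ Set.Ioo (0:ℝ) 1, J a (J a b) = b) ∧
  (∀ a ∈ Set.Ioo (0:ℝ) 1, ∀ b ∈ Set.Ioo (0:ℝ) 1, J a b + J b a = 1) ∧
  (∀ b₀ ∈ Set.Ioo (0:ℝ) 1, StrictMonoOn (fun a => J a b₀) (Set.Ioo 0 1))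

/-- `J a b = J (1 - b) (1 - a)` for all `a, b` in `(0,1)`. -/
theorem stmt_2 (J : ℝ → ℝ → ℝ) (hJ : IsJamesian J) :
    ∀ a ∈ Ioo (0:ℝ) 1, ∀ b ∈ Ioo (0:ℝ) 1, J a b = J (1 - b) (1 - a) := by
  obtain ⟨hmem, hinv, hsum, -⟩ := hJ
  intro a ha b hb
  have hc := hmem a ha b hb
  have hb' : 1 - b ∈ Ioo (0:ℝ) 1 := ⟨by linarith [hb.2], by linarith [hb.1]⟩
  have hca : J (J a b) a = 1 - b := by
    linarith [hsum a ha _ hc, hinv a ha b hb]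
  have hcb : J (J a b) (1 - b) = a := hca ▸ hinv _ hc a ha
  have hbc : J (1 - b) (J a b) = 1 - a := by
    linarith [hsum _ hc _ hb']
  rw [← hbc, hinv _ hb' _ hc]
end

section
/- Every involutive Jamesian function J is continuous on (0,1) × (0,1) (with respect to the standard topology). -/
open Set

namespace IsJamesian

variable {J : ℝ → ℝ → ℝ}

/-- In its second argument an involutive Jamesian function is strictly decreasing. -/
theorem strictAntiOn (hJ : IsJamesian J) {a : ℝ} (ha : a ∈ Ioo (0 : ℝ) 1) :
    StrictAntiOn (J a) (Ioo 0 1) := by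
  intro x hx y hy hxy
  have h : J x a < J y a := hJ.2.2.2 a ha hx hy hxy
  linarith [hJ.2.2.1 a ha x hx, hJ.2.2.1 a ha y hy]

/-- A strict upper bound at `(a, b)` holds on a quadrant having `(a, b)` in its interior. -/
theorem exists_forall_lt (hJ : IsJamesian J) {a b u : ℝ} (ha : a ∈ Ioo (0 : ℝ) 1)
    (hb : b ∈ Ioo (0 : ℝ) 1) (hu : J a b < u) :
    ∃ a₁ > a, ∃ b₁ < b, ∀ x ∈ Ioo (0 : ℝ) 1, ∀ y ∈ Ioo (0 : ℝ) 1,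
      x < a₁ → b₁ < y → J x y < u := by
  have hanti := @hJ.strictAntiOn
  obtain ⟨hmem, hinv, hadd, hmono⟩ := hJ
  have hc := hmem a ha b hb
  rcases le_or_gt 1 u with hu1 | hu1
  · exact ⟨a + 1, by linarith, b - 1, by linarith,
      fun x hx y hy _ _ => (hmem x hx y hy).2.trans_le hu1⟩
  obtain ⟨v, hcv, hvu⟩ := exists_between hu
  have hv : v ∈ Ioo (0 : ℝ) 1 := ⟨hc.1.trans hcv, hvu.trans hu1⟩
  have hu' : 1 - u ∈ Ioo (0 : ℝ) 1 := ⟨by linarith, by linarith [hc.1]⟩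
  have hb₁ := hmem a ha v hv
  have ha₁ := hmem _ hb₁ _ hu'
  have hval : J (J (J a v) (1 - u)) (J a v) = u := by
    linarith [hadd _ hb₁ _ ha₁, hinv _ hb₁ _ hu']
  refine ⟨J (J a v) (1 - u), ?_, J a v, ?_, fun x hx y hy hxa hby => ?_⟩
  · refine ((hmono _ hb₁).lt_iff_lt ha ha₁).1 ?_
    simpa only [hval, hinv a ha v hv] using hvu
  · simpa only [hinv a ha b hb] using hanti ha hc hv hcv
  · calc J x y < J x (J a v) := hanti hx hb₁ hy hby
      _ < J (J (J a v) (1 - u)) (J a v) := hmono _ hb₁ hx ha₁ hxa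
      _ = u := hval

end IsJamesian

/-- every involutive Jamesian function is continuous on
`(0,1) x (0,1)`. -/
theorem stmt_4 (J : ℝ → ℝ → ℝ) (hJ : IsJamesian J) :
    ContinuousOn (fun p : ℝ × ℝ => J p.1 p.2) (Ioo 0 1 ×ˢ Ioo 0 1) := by
  rintro ⟨a, b⟩ ⟨ha, hb⟩
  have hadd := hJ.2.2.1
  refine tendsto_order.2 ⟨fun l hl => ?_, fun u hu => ?_⟩
  · have hl' : J b a < 1 - l := by
      have : l < J a b := hl
      linarith [hadd a ha b hb]
    obtain ⟨b₁, hb₁, a₁, ha₁, h⟩ := hJ.exists_forall_lt hb ha hl'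
    filter_upwards [self_mem_nhdsWithin, mem_nhdsWithin_of_mem_nhds
      (prod_mem_nhds (Ioi_mem_nhds ha₁) (Iio_mem_nhds hb₁))] with p hp hq
    linarith [h p.2 hp.2 p.1 hp.1 hq.2 hq.1, hadd p.1 hp.1 p.2 hp.2]
  · obtain ⟨a₁, ha₁, b₁, hb₁, h⟩ := hJ.exists_forall_lt ha hb hu
    filter_upwards [self_mem_nhdsWithin, mem_nhdsWithin_of_mem_nhds
      (prod_mem_nhds (Iio_mem_nhds ha₁) (Ioi_mem_nhds hb₁))] with p hp hq
    exact h p.1 hp.1 p.2 hp.2 hq.1 hq.2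
end

section
/- Let J be an involutive Jamesian function and let a ∈ (0,1). If (bₙ) is a strictly decreasing sequence in (0,1) with bₙ → 0, then J(a, bₙ) → 1. -/
open Set

/-- An involutive Jamesian function is strictly decreasing in its second argument. -/
theorem IsJamesian.strictAntiOn_s5 {J : ℝ → ℝ → ℝ} (hJ : IsJamesian J) {a : ℝ}
    (ha : a ∈ Ioo (0:ℝ) 1) : StrictAntiOn (J a) (Ioo 0 1) := by
  obtain ⟨-, -, hsum, hmono⟩ := hJ
  intro x hx y hy hxy
  have h : J x a < J y a := hmono a ha hx hy hxy
  linarith [hsum a ha x hx, hsum a ha y hy]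

/-- if `b n` is a strictly decreasing sequence in `(0,1)` with
`b n → 0`, then `J a (b n) → 1`. -/
theorem stmt_5 (J : ℝ → ℝ → ℝ) (hJ : IsJamesian J)
    (a : ℝ) (ha : a ∈ Ioo (0:ℝ) 1)
    (b : ℕ → ℝ) (hb : ∀ n, b n ∈ Ioo (0:ℝ) 1)
    (hanti : StrictAnti b)
    (hlim : Filter.Tendsto b Filter.atTop (nhds 0)) :
    Filter.Tendsto (fun n => J a (b n)) Filter.atTop (nhds 1) := by
  refine tendsto_order.2 ⟨fun c hc => ?_, fun c hc =>
    Filter.Eventually.of_forall fun n => (hJ.1 a ha _ (hb n)).2.trans hc⟩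
  obtain ⟨d, hd, hd1⟩ := exists_between (max_lt hc one_pos)
  have hdI : d ∈ Ioo (0:ℝ) 1 := ⟨(le_max_right _ _).trans_lt hd, hd1⟩
  have hJd := hJ.1 a ha d hdI
  filter_upwards [hlim.eventually_lt_const hJd.1] with n hn
  have h := hJ.strictAntiOn_s5 ha (hb n) hJd hn
  rw [hJ.2.1 a ha d hdI] at h
  exact ((le_max_left _ _).trans_lt hd).trans h
end

section
/- Let J be an involutive Jamesian function. Then the following three conditions are equivalent: (1) J(J(a,c), J(b,c)) = J(a,b) for every a, b, c ∈ (0,1) (transitivity); (2) J(J(a,b), J(a,c)) = J(c,b) for every a, b, c ∈ (0,1); (3) J(b, J(a,c)) = J(c, J(a,b)) for every a, b, c ∈ (0,1). -/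
open Set

theorem one_sub_mem_Ioo {x : ℝ} (hx : x ∈ Ioo (0:ℝ) 1) : 1 - x ∈ Ioo (0:ℝ) 1 :=
  ⟨sub_pos.2 hx.2, sub_lt_self 1 hx.1⟩

/-- Involutivity and antisymmetry make the relation `J a b = c` invariant under the rotation
`(a, b, c) ↦ (b, 1 - c, a)`. -/
theorem IsJamesian.rotate {J : ℝ → ℝ → ℝ} (hJ : IsJamesian J) {a b : ℝ}
    (ha : a ∈ Ioo (0:ℝ) 1) (hb : b ∈ Ioo (0:ℝ) 1) : J b (1 - J a b) = a := by
  obtain ⟨-, hinv, hadd, -⟩ := hJ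
  rw [← hadd a ha b hb, add_sub_cancel_left, hinv b hb a ha]

theorem IsJamesian.one_sub_one_sub {J : ℝ → ℝ → ℝ} (hJ : IsJamesian J) {a b : ℝ}
    (ha : a ∈ Ioo (0:ℝ) 1) (hb : b ∈ Ioo (0:ℝ) 1) : J (1 - a) (1 - b) = J b a := by
  have hc : 1 - J a b ∈ Ioo (0:ℝ) 1 := one_sub_mem_Ioo (hJ.1 a ha b hb)
  have h₁ : J (1 - J a b) (1 - a) = b := by
    simpa only [hJ.rotate ha hb] using hJ.rotate hb hc
  have h₂ : J (1 - a) (1 - b) = 1 - J a b := by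
    simpa only [h₁] using hJ.rotate hc (one_sub_mem_Ioo ha)
  linarith [hJ.2.2.1 a ha b hb]

theorem IsJamesian.apply_apply_right {J : ℝ → ℝ → ℝ} (hJ : IsJamesian J) {a b c : ℝ}
    (ha : a ∈ Ioo (0:ℝ) 1) (hb : b ∈ Ioo (0:ℝ) 1) (hc : c ∈ Ioo (0:ℝ) 1) :
    J (J a c) (J b c) = J (J c b) (J c a) := by
  rw [← hJ.one_sub_one_sub (hJ.1 c hc a ha) (hJ.1 c hc b hb),
    eq_sub_of_add_eq (hJ.2.2.1 a ha c hc), eq_sub_of_add_eq (hJ.2.2.1 b hb c hc)]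

/-- for an involutive Jamesian function the three conditions
(transitivity and its two reformulations) are equivalent. -/
theorem stmt_6 (J : ℝ → ℝ → ℝ) (hJ : IsJamesian J) :
    ((∀ a ∈ Ioo (0:ℝ) 1, ∀ b ∈ Ioo (0:ℝ) 1, ∀ c ∈ Ioo (0:ℝ) 1,
        J (J a c) (J b c) = J a b) ↔
      (∀ a ∈ Ioo (0:ℝ) 1, ∀ b ∈ Ioo (0:ℝ) 1, ∀ c ∈ Ioo (0:ℝ) 1,
        J (J a b) (J a c) = J c b)) ∧
    ((∀ a ∈ Ioo (0:ℝ) 1, ∀ b ∈ Ioo (0:ℝ) 1, ∀ c ∈ Ioo (0:ℝ) 1,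
        J (J a b) (J a c) = J c b) ↔
      (∀ a ∈ Ioo (0:ℝ) 1, ∀ b ∈ Ioo (0:ℝ) 1, ∀ c ∈ Ioo (0:ℝ) 1,
        J b (J a c) = J c (J a b))) := by
  have hmem := hJ.1
  have hinv := hJ.2.1
  have hadd := hJ.2.2.1
  refine ⟨⟨fun h a ha b hb c hc => ?_, fun h a ha b hb c hc => ?_⟩,
    fun h a ha b hb c hc => ?_, fun h a ha b hb c hc => ?_⟩
  · rw [← hJ.apply_apply_right hc hb ha, h c hc b hb a ha]
  · rw [hJ.apply_apply_right ha hb hc, h c hc b hb a ha]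
  · have key := h a ha b hb (J a c) (hmem a ha c hc)
    rw [hinv a ha c hc] at key
    linarith [hadd b hb _ (hmem a ha c hc), hadd c hc _ (hmem a ha b hb)]
  · have key := h a ha c hc (J a b) (hmem a ha b hb)
    rw [hinv a ha b hb] at key
    exact key.symm
end

section
/- An involutive Jamesian function J is f-representable if and only if it is transitive, i.e. J(J(a,c), J(b,c)) = J(a,b) for every a, b, c ∈ (0,1). -/
open Set

/-- `J` is `f`-representable: there is a strictly increasing homeomorphism
`f : (0,1) → ℝ` (with inverse `g`) satisfying `f (1 - a) = - f a`, such that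
`J a b = f⁻¹ (f a - f b)`. -/
def IsRepresentable (J : ℝ → ℝ → ℝ) : Prop :=
  ∃ f g : ℝ → ℝ,
    ContinuousOn f (Set.Ioo 0 1) ∧
    StrictMonoOn f (Set.Ioo 0 1) ∧
    Continuous g ∧
    (∀ y : ℝ, g y ∈ Set.Ioo (0:ℝ) 1) ∧
    (∀ x ∈ Set.Ioo (0:ℝ) 1, g (f x) = x) ∧
    (∀ y : ℝ, f (g y) = y) ∧
    (∀ a ∈ Set.Ioo (0:ℝ) 1, f (1 - a) = - f a) ∧
    (∀ a ∈ Set.Ioo (0:ℝ) 1, ∀ b ∈ Set.Ioo (0:ℝ) 1, J a b = g (f a - f b))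

/-- `J` is transitive: `J (J a c) (J b c) = J a b` on `(0,1)`. -/
def IsTransitive (J : ℝ → ℝ → ℝ) : Prop :=
  ∀ a ∈ Set.Ioo (0:ℝ) 1, ∀ b ∈ Set.Ioo (0:ℝ) 1, ∀ c ∈ Set.Ioo (0:ℝ) 1,
    J (J a c) (J b c) = J a b

section OrderedGroup

variable {G : Type*} [AddCommGroup G] [LinearOrder G] [IsOrderedAddMonoid G]

/-- A Dedekind complete linearly ordered abelian group is archimedean. -/
theorem archimedean_of_exists_isLUB
    (hsup : ∀ s : Set G, s.Nonempty → BddAbove s → ∃ x, IsLUB s x) : Archimedean G := by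
  refine ⟨fun y x hx => ?_⟩
  by_contra! h
  obtain ⟨s, hs⟩ := hsup (Set.range fun n : ℕ => n • x) (Set.range_nonempty _)
    ⟨y, by rintro _ ⟨n, rfl⟩; exact (h n).le⟩
  obtain ⟨_, ⟨n, rfl⟩, hn, -⟩ := hs.exists_between (sub_lt_self s hx)
  have hle : (n + 1) • x ≤ s := hs.1 ⟨n + 1, rfl⟩
  rw [succ_nsmul] at hle
  exact absurd (sub_lt_iff_lt_add.1 hn) hle.not_gt

/-- A nontrivial, densely ordered, Dedekind complete linearly ordered abelian group is isomorphic
to the additive group of the reals. -/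
theorem nonempty_orderAddMonoidIso_real [DenselyOrdered G] [Nontrivial G]
    (hsup : ∀ s : Set G, s.Nonempty → BddAbove s → ∃ x, IsLUB s x) :
    Nonempty (G ≃+o ℝ) := by
  have := archimedean_of_exists_isLUB hsup
  obtain ⟨φ, hφ⟩ := Archimedean.exists_orderAddMonoidHom_real_injective G
  have hmono : StrictMono φ := (OrderHomClass.mono φ).strictMono_of_injective hφ
  have hdense : Dense ((φ : G →+ ℝ).range : Set ℝ) := by
    refine AddSubgroup.dense_of_no_min _ ?_ ?_
    · intro hbot
      obtain ⟨x, hx⟩ := exists_ne (0 : G)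
      have hmem : φ x ∈ (φ : G →+ ℝ).range := ⟨x, rfl⟩
      rw [hbot, AddSubgroup.mem_bot] at hmem
      exact hx (hφ (hmem.trans (map_zero φ).symm))
    · rintro ⟨_, ⟨⟨x, rfl⟩, hx⟩, hmin⟩
      have hx0 : 0 < x := hmono.lt_iff_lt.1 (by simpa using hx)
      obtain ⟨z, hz0, hzx⟩ := exists_between hx0
      have hz : 0 < φ z := by simpa using hmono hz0
      exact (hmono hzx).not_ge (hmin ⟨⟨z, rfl⟩, hz⟩)
  have hbetween : ∀ u v : ℝ, u < v → ∃ t, u < φ t ∧ φ t < v := by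
    intro u v huv
    obtain ⟨_, ⟨t, rfl⟩, h⟩ := hdense.exists_between huv
    exact ⟨t, h⟩
  have hsurj : Function.Surjective φ := by
    intro y
    obtain ⟨l, -, hl⟩ := hbetween (y - 1) y (by linarith)
    obtain ⟨u, hu, -⟩ := hbetween y (y + 1) (by linarith)
    obtain ⟨s, hs⟩ := hsup {x | φ x < y} ⟨l, hl⟩
      ⟨u, fun x hx => (hmono.lt_iff_lt.1 (lt_trans hx hu)).le⟩
    refine ⟨s, le_antisymm ?_ ?_⟩
    · by_contra! h
      obtain ⟨t, hyt, hts⟩ := hbetween _ _ h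
      exact (hmono.lt_iff_lt.1 hts).not_ge
        (hs.2 fun x hx => (hmono.lt_iff_lt.1 (lt_trans hx hyt)).le)
    · by_contra! h
      obtain ⟨t, hst, hty⟩ := hbetween _ _ h
      exact (hmono.lt_iff_lt.1 hst).not_ge (hs.1 hty)
  exact ⟨{ AddEquiv.ofBijective (φ : G →+ ℝ) ⟨hφ, hsurj⟩ with
    map_le_map_iff' := hmono.le_iff_le }⟩

end OrderedGroup

theorem exists_isLUB_of_ordConnected {s : Set ℝ} [s.OrdConnected] (t : Set s)
    (ht : t.Nonempty) (hb : BddAbove t) : ∃ x, IsLUB t x := by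
  have : Inhabited s := ⟨ht.some⟩
  exact ⟨sSup t, isLUB_csSup ht hb⟩

theorem IsRepresentable.isTransitive {J : ℝ → ℝ → ℝ} (h : IsRepresentable J) :
    IsTransitive J := by
  obtain ⟨f, g, -, -, -, hg, -, hfg, -, hJ⟩ := h
  intro a ha b hb c hc
  rw [hJ a ha c hc, hJ b hb c hc, hJ _ (hg _) _ (hg _), hfg, hfg, hJ a ha b hb,
    sub_sub_sub_cancel_right]

namespace IsJamesian

variable {J : ℝ → ℝ → ℝ} {a b c : ℝ}

theorem one_half_mem : (1 / 2 : ℝ) ∈ Ioo (0 : ℝ) 1 := by norm_num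

theorem one_sub_mem (ha : a ∈ Ioo (0 : ℝ) 1) : 1 - a ∈ Ioo (0 : ℝ) 1 :=
  ⟨by linarith [ha.2], by linarith [ha.1]⟩

theorem mem (hJ : IsJamesian J) (ha : a ∈ Ioo (0 : ℝ) 1) (hb : b ∈ Ioo (0 : ℝ) 1) :
    J a b ∈ Ioo (0 : ℝ) 1 :=
  hJ.1 a ha b hb

theorem involutive (hJ : IsJamesian J) (ha : a ∈ Ioo (0 : ℝ) 1) (hb : b ∈ Ioo (0 : ℝ) 1) :
    J a (J a b) = b :=
  hJ.2.1 a ha b hb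

theorem swap (hJ : IsJamesian J) (ha : a ∈ Ioo (0 : ℝ) 1) (hb : b ∈ Ioo (0 : ℝ) 1) :
    J b a = 1 - J a b := by
  linarith [hJ.2.2.1 a ha b hb]

theorem self (hJ : IsJamesian J) (ha : a ∈ Ioo (0 : ℝ) 1) : J a a = 1 / 2 := by
  linarith [hJ.swap ha ha]

theorem right_half (hJ : IsJamesian J) (ha : a ∈ Ioo (0 : ℝ) 1) : J a (1 / 2) = a := by
  simpa only [hJ.self ha] using hJ.involutive ha ha

/-- Writing `a + b` for `J a (1 - b)`, this is `(a + b) - a = b`. -/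
theorem add_sub_cancel_left (hJ : IsJamesian J) (ha : a ∈ Ioo (0 : ℝ) 1)
    (hb : b ∈ Ioo (0 : ℝ) 1) : J (J a (1 - b)) a = b := by
  rw [hJ.swap ha (hJ.mem ha (one_sub_mem hb)), hJ.involutive ha (one_sub_mem hb), sub_sub_cancel]

/-- Writing `a + b` for `J a (1 - b)`, this is `(a + b) - b = a`. -/
theorem add_sub_cancel_right (hJ : IsJamesian J) (ha : a ∈ Ioo (0 : ℝ) 1)
    (hb : b ∈ Ioo (0 : ℝ) 1) : J (J a (1 - b)) b = a := by
  have h := hJ.involutive (hJ.mem ha (one_sub_mem hb)) ha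
  rwa [hJ.add_sub_cancel_left ha hb] at h

theorem add_comm (hJ : IsJamesian J) (ha : a ∈ Ioo (0 : ℝ) 1) (hb : b ∈ Ioo (0 : ℝ) 1) :
    J a (1 - b) = J b (1 - a) := by
  have hab := hJ.mem ha (one_sub_mem hb)
  have h := hJ.involutive hb hab
  rw [hJ.swap hab hb, hJ.add_sub_cancel_right ha hb] at h
  exact h.symm

/-- Writing `a + b` for `J a (1 - b)`, this is `(a - b) + b = a`. -/
theorem sub_add_cancel (hJ : IsJamesian J) (hT : IsTransitive J) (ha : a ∈ Ioo (0 : ℝ) 1)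
    (hb : b ∈ Ioo (0 : ℝ) 1) : J (J a b) (1 - b) = a := by
  have h := hT a ha (1 / 2) one_half_mem b hb
  rwa [hJ.right_half ha, hJ.swap hb one_half_mem, hJ.right_half hb] at h

theorem add_assoc (hJ : IsJamesian J) (hT : IsTransitive J) (ha : a ∈ Ioo (0 : ℝ) 1)
    (hb : b ∈ Ioo (0 : ℝ) 1) (hc : c ∈ Ioo (0 : ℝ) 1) :
    J (J a (1 - b)) (1 - c) = J a (1 - J b (1 - c)) := by
  have hab := hJ.mem ha (one_sub_mem hb)
  have hp := hJ.mem hab (one_sub_mem hc)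
  have hq := hJ.mem hb (one_sub_mem hc)
  have h := hT _ hp _ hq c hc
  rw [hJ.add_sub_cancel_right hab hc, hJ.add_sub_cancel_right hb hc,
    hJ.add_sub_cancel_right ha hb] at h
  conv_rhs => rw [h]
  exact (hJ.sub_add_cancel hT hp hq).symm

/-- A transitive involutive Jamesian function is the subtraction of an abelian group structure
on `(0,1)` with neutral element `1 / 2` and inversion `a ↦ 1 - a`. -/
@[reducible]
noncomputable def addCommGroup (hJ : IsJamesian J) (hT : IsTransitive J) :
    AddCommGroup (Ioo (0 : ℝ) 1) :=
  letI : Add (Ioo (0 : ℝ) 1) := ⟨fun a b => ⟨J a (1 - b), hJ.mem a.2 (one_sub_mem b.2)⟩⟩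
  letI : Zero (Ioo (0 : ℝ) 1) := ⟨⟨1 / 2, one_half_mem⟩⟩
  letI : Neg (Ioo (0 : ℝ) 1) := ⟨fun a => ⟨1 - a, one_sub_mem a.2⟩⟩
  { sub := fun a b => ⟨J a b, hJ.mem a.2 b.2⟩
    add_assoc := fun a b c => Subtype.ext (hJ.add_assoc hT a.2 b.2 c.2)
    add_comm := fun a b => Subtype.ext (hJ.add_comm a.2 b.2)
    zero_add := fun a => Subtype.ext <| by
      change J (1 / 2) (1 - a) = a
      rw [hJ.add_comm one_half_mem a.2, sub_half, hJ.right_half a.2]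
    add_zero := fun a => Subtype.ext <| by
      change J a (1 - 1 / 2) = a
      rw [sub_half, hJ.right_half a.2]
    neg_add_cancel := fun a => Subtype.ext (hJ.self (one_sub_mem a.2))
    sub_eq_add_neg := fun a b => Subtype.ext <| by
      change J a b = J a (1 - (1 - b))
      rw [sub_sub_cancel]
    nsmul := nsmulRec
    zsmul := zsmulRec }

theorem isRepresentable (hJ : IsJamesian J) (hT : IsTransitive J) : IsRepresentable J := by
  let := hJ.addCommGroup hT
  have : IsOrderedAddMonoid (Ioo (0 : ℝ) 1) :=
    { add_le_add_left := fun a b hab c =>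
        (hJ.2.2.2 _ (one_sub_mem c.2)).monotoneOn a.2 b.2 hab }
  have : Nontrivial (Ioo (0 : ℝ) 1) :=
    ⟨⟨1 / 2, one_half_mem⟩, ⟨1 / 3, by norm_num⟩, by simp [Subtype.ext_iff]⟩
  obtain ⟨φ⟩ := nonempty_orderAddMonoidIso_real (G := Ioo (0 : ℝ) 1) exists_isLUB_of_ordConnected
  let e : Ioo (0 : ℝ) 1 ≃o ℝ := ⟨φ.toEquiv, φ.map_le_map_iff'⟩
  let f : ℝ → ℝ := Function.extend Subtype.val e 0
  have hf : ∀ x : Ioo (0 : ℝ) 1, f x = e x := Subtype.val_injective.extend_apply e 0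
  refine ⟨f, fun y => e.symm y, ?_, ?_, ?_, fun y => (e.symm y).2, ?_, ?_, ?_, ?_⟩
  · rw [continuousOn_iff_continuous_domRestrict]
    exact e.continuous.congr fun x => (hf x).symm
  · intro a ha b hb hab
    rw [hf ⟨a, ha⟩, hf ⟨b, hb⟩]
    exact e.strictMono hab
  · exact continuous_subtype_val.comp e.symm.continuous
  · intro x hx
    simp [hf ⟨x, hx⟩]
  · intro y
    simp [hf]
  · intro a ha
    rw [hf ⟨a, ha⟩, hf ⟨1 - a, one_sub_mem ha⟩]
    exact map_neg φ ⟨a, ha⟩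
  · intro a ha b hb
    have h : e ⟨J a b, hJ.mem ha hb⟩ = e ⟨a, ha⟩ - e ⟨b, hb⟩ :=
      map_sub φ ⟨a, ha⟩ ⟨b, hb⟩
    rw [hf ⟨a, ha⟩, hf ⟨b, hb⟩, ← h]
    simp

end IsJamesian

/-- an involutive Jamesian function is `f`-representable iff it
is transitive. -/
theorem stmt_7 (J : ℝ → ℝ → ℝ) (hJ : IsJamesian J) :
    IsRepresentable J ↔ IsTransitive J :=
  ⟨IsRepresentable.isTransitive, hJ.isRepresentable⟩
end

section
/- Let J be an involutive Jamesian function and define the binary operation · on (0,1) by a · b = J(a, 1−b). Then: (1) · is commutative; (2) a · (1/2) = (1/2) · a = a for every a ∈ (0,1), so 1/2 is an identity; (3) a · (1−a) = 1/2 for every a ∈ (0,1), so 1−a is the inverse of a; (4) a · (b · (1−a)) = b for every a, b ∈ (0,1) (inverse property); (5) for each fixed b₀ ∈ (0,1), the right translation a ↦ a · b₀ is strictly increasing. -/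
open Set

/-- the operation `a * b = J a (1 - b)` induced by an involutive
Jamesian function is a Jamesian loop: commutative, with identity `1/2`,
inverse `1 - a`, the inverse property, and strictly increasing translations. -/
theorem stmt_8 (J : ℝ → ℝ → ℝ) (hJ : IsJamesian J)
    (m : ℝ → ℝ → ℝ) (hm : ∀ a b : ℝ, m a b = J a (1 - b)) :
    (∀ a ∈ Ioo (0:ℝ) 1, ∀ b ∈ Ioo (0:ℝ) 1, m a b = m b a) ∧
    (∀ a ∈ Ioo (0:ℝ) 1, m a (1 / 2) = a ∧ m (1 / 2) a = a) ∧
    (∀ a ∈ Ioo (0:ℝ) 1, m a (1 - a) = 1 / 2) ∧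
    (∀ a ∈ Ioo (0:ℝ) 1, ∀ b ∈ Ioo (0:ℝ) 1, m a (m b (1 - a)) = b) ∧
    (∀ b₀ ∈ Ioo (0:ℝ) 1, StrictMonoOn (fun a => m a b₀) (Ioo 0 1)) := by
  obtain ⟨hmem, hinv, hadd, hmono⟩ := hJ
  have hcompl {a : ℝ} (ha : a ∈ Ioo (0:ℝ) 1) : 1 - a ∈ Ioo (0:ℝ) 1 :=
    ⟨by linarith [ha.2], by linarith [ha.1]⟩
  have hdiag (a : ℝ) (ha : a ∈ Ioo (0:ℝ) 1) : J a a = 1 / 2 := by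
    linarith [hadd a ha a ha]
  have hhalf (a : ℝ) (ha : a ∈ Ioo (0:ℝ) 1) : J a (1 / 2) = a := by
    simpa only [hdiag a ha] using hinv a ha a ha
  have hreflect (a : ℝ) (ha : a ∈ Ioo (0:ℝ) 1) (b : ℝ) (hb : b ∈ Ioo (0:ℝ) 1) :
      J (1 - b) (1 - a) = J a b := by
    have hc := hmem a ha b hb
    have h₁ : J (J a b) a = 1 - b := by
      linarith [hadd a ha _ hc, hinv a ha b hb]
    have h₂ : J (J a b) (1 - b) = a := by
      simpa only [h₁] using hinv _ hc a ha
    have h₃ : J (1 - b) (J a b) = 1 - a := by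
      linarith [hadd _ hc _ (hcompl hb)]
    simpa only [h₃] using hinv _ (hcompl hb) _ hc
  have hcomm (a : ℝ) (ha : a ∈ Ioo (0:ℝ) 1) (b : ℝ) (hb : b ∈ Ioo (0:ℝ) 1) :
      m a b = m b a := by
    rw [hm, hm, ← hreflect a ha _ (hcompl hb), sub_sub_cancel]
  have hid (a : ℝ) (ha : a ∈ Ioo (0:ℝ) 1) : m a (1 / 2) = a := by
    rw [hm, sub_half, hhalf a ha]
  refine ⟨hcomm, fun a ha => ⟨hid a ha, ?_⟩, fun a ha => ?_, fun a ha b hb => ?_,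
    fun b₀ hb₀ => ?_⟩
  · rw [hcomm _ (by norm_num) a ha, hid a ha]
  · rw [hm, sub_sub_cancel, hdiag a ha]
  · rw [hm, hm, sub_sub_cancel, ← eq_sub_of_add_eq (hadd a ha b hb), hinv a ha b hb]
  · simpa only [hm] using hmono _ (hcompl hb₀)
end

section
/- Let · : (0,1) × (0,1) → (0,1) be a binary operation which is commutative, satisfies a · (1/2) = a for all a ∈ (0,1), satisfies a · (1−a) = 1/2 for all a ∈ (0,1), satisfies the inverse property a · (b · (1−a)) = b for all a, b ∈ (0,1), and such that for each fixed b₀ ∈ (0,1) the map a ↦ a · b₀ is strictly increasing. Then the function J defined by J(a,b) = a · (1−b) is an involutive Jamesian function. -/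
open Set

theorem one_sub_mem_Ioo_s9 {a : ℝ} (ha : a ∈ Ioo (0:ℝ) 1) : 1 - a ∈ Ioo (0:ℝ) 1 :=
  ⟨sub_pos.2 ha.2, sub_lt_self 1 ha.1⟩

/-- In a commutative inverse property loop on `(0,1)` with inversion `a ↦ 1 - a`, inversion is an
automorphism. -/
theorem one_sub_mul_eq_of_inverse_property {m : ℝ → ℝ → ℝ}
    (hmem : ∀ a ∈ Ioo (0:ℝ) 1, ∀ b ∈ Ioo (0:ℝ) 1, m a b ∈ Ioo (0:ℝ) 1)
    (hcomm : ∀ a ∈ Ioo (0:ℝ) 1, ∀ b ∈ Ioo (0:ℝ) 1, m a b = m b a)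
    (hIP : ∀ a ∈ Ioo (0:ℝ) 1, ∀ b ∈ Ioo (0:ℝ) 1, m a (m b (1 - a)) = b)
    {a b : ℝ} (ha : a ∈ Ioo (0:ℝ) 1) (hb : b ∈ Ioo (0:ℝ) 1) :
    1 - m a b = m (1 - a) (1 - b) := by
  have ha' := one_sub_mem_Ioo_s9 ha
  have hb' := one_sub_mem_Ioo_s9 hb
  have hc := hmem a ha b hb
  have hc' := one_sub_mem_Ioo_s9 hc
  have h₁ : m (1 - a) (m a b) = b := by
    simpa [hcomm a ha b hb] using hIP (1 - a) ha' b hb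
  have h₂ : m (1 - m a b) b = 1 - a := by
    simpa [h₁] using hIP (1 - m a b) hc' (1 - a) ha'
  have h₃ : m (1 - b) (1 - a) = 1 - m a b := by
    simpa [h₂] using hIP (1 - b) hb' (1 - m a b) hc'
  rw [← h₃, hcomm _ hb' _ ha']

/-- if `m` is a Jamesian loop on `(0,1)` (commutative, identity
`1/2`, `a * (1 - a) = 1/2`, inverse property, strictly increasing
translations), then `J a b = m a (1 - b)` is an involutive Jamesian
function. -/
theorem stmt_9 (m : ℝ → ℝ → ℝ)
    (hmem : ∀ a ∈ Ioo (0:ℝ) 1, ∀ b ∈ Ioo (0:ℝ) 1, m a b ∈ Ioo (0:ℝ) 1)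
    (hcomm : ∀ a ∈ Ioo (0:ℝ) 1, ∀ b ∈ Ioo (0:ℝ) 1, m a b = m b a)
    (hid : ∀ a ∈ Ioo (0:ℝ) 1, m a (1 / 2) = a)
    (hinv : ∀ a ∈ Ioo (0:ℝ) 1, m a (1 - a) = 1 / 2)
    (hIP : ∀ a ∈ Ioo (0:ℝ) 1, ∀ b ∈ Ioo (0:ℝ) 1, m a (m b (1 - a)) = b)
    (hmono : ∀ b₀ ∈ Ioo (0:ℝ) 1, StrictMonoOn (fun a => m a b₀) (Ioo 0 1))
    (J : ℝ → ℝ → ℝ) (hJ : ∀ a b : ℝ, J a b = m a (1 - b)) :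
    (∀ a ∈ Ioo (0:ℝ) 1, ∀ b ∈ Ioo (0:ℝ) 1, J a b ∈ Ioo (0:ℝ) 1) ∧
    (∀ a ∈ Ioo (0:ℝ) 1, ∀ b ∈ Ioo (0:ℝ) 1, J a (J a b) = b) ∧
    (∀ a ∈ Ioo (0:ℝ) 1, ∀ b ∈ Ioo (0:ℝ) 1, J a b + J b a = 1) ∧
    (∀ b₀ ∈ Ioo (0:ℝ) 1, StrictMonoOn (fun a => J a b₀) (Ioo 0 1)) := by
  have hsub : ∀ a ∈ Ioo (0:ℝ) 1, ∀ b ∈ Ioo (0:ℝ) 1, 1 - m a (1 - b) = m b (1 - a) := by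
    intro a ha b hb
    rw [one_sub_mul_eq_of_inverse_property hmem hcomm hIP ha (one_sub_mem_Ioo_s9 hb), sub_sub_cancel,
      hcomm _ (one_sub_mem_Ioo_s9 ha) _ hb]
  simp only [hJ]
  refine ⟨fun a ha b hb => hmem a ha _ (one_sub_mem_Ioo_s9 hb), fun a ha b hb => ?_,
    fun a ha b hb => ?_, fun b hb => hmono _ (one_sub_mem_Ioo_s9 hb)⟩
  · rw [hsub a ha b hb, hIP a ha b hb]
  · rw [← hsub a ha b hb, add_sub_cancel]
end

section
/- Let J be an involutive Jamesian function and define a · b = J(a, 1−b) for a, b ∈ (0,1). Then the operation · is associative (i.e. (a · b) · c = a · (b · c) for all a, b, c ∈ (0,1)) if and only if J(c, J(b,a)) = J(a, J(b,c)) for every a, b, c ∈ (0,1). -/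
open Set

/-- An involutive Jamesian function satisfies `J a b = J (1 - b) (1 - a)`. -/
theorem IsJamesian.eq_one_sub_one_sub {J : ℝ → ℝ → ℝ} (hJ : IsJamesian J) {a b : ℝ}
    (ha : a ∈ Ioo (0:ℝ) 1) (hb : b ∈ Ioo (0:ℝ) 1) : J a b = J (1 - b) (1 - a) := by
  obtain ⟨hmem, hinv, hadd, -⟩ := hJ
  have hb' : 1 - b ∈ Ioo (0:ℝ) 1 := ⟨by linarith [hb.2], by linarith [hb.1]⟩
  have hx := hmem a ha b hb
  have hxa : J (J a b) a = 1 - b := by linarith [hadd a ha _ hx, hinv a ha b hb]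
  have hxb : J (J a b) (1 - b) = a := hxa ▸ hinv _ hx a ha
  have hbx : J (1 - b) (J a b) = 1 - a := by linarith [hadd _ hx _ hb']
  rw [← hbx, hinv _ hb' _ hx]

/-- the induced operation `a * b = J a (1 - b)` is associative
iff `J c (J b a) = J a (J b c)` for all `a, b, c` in `(0,1)`. -/
theorem stmt_10 (J : ℝ → ℝ → ℝ) (hJ : IsJamesian J)
    (m : ℝ → ℝ → ℝ) (hm : ∀ a b : ℝ, m a b = J a (1 - b)) :
    (∀ a ∈ Ioo (0:ℝ) 1, ∀ b ∈ Ioo (0:ℝ) 1, ∀ c ∈ Ioo (0:ℝ) 1,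
        m (m a b) c = m a (m b c)) ↔
    (∀ a ∈ Ioo (0:ℝ) 1, ∀ b ∈ Ioo (0:ℝ) 1, ∀ c ∈ Ioo (0:ℝ) 1,
        J c (J b a) = J a (J b c)) := by
  have hsub : ∀ {x : ℝ}, x ∈ Ioo (0:ℝ) 1 → 1 - x ∈ Ioo (0:ℝ) 1 :=
    fun hx => ⟨by linarith [hx.2], by linarith [hx.1]⟩
  have hcompl : ∀ {x y : ℝ}, x ∈ Ioo (0:ℝ) 1 → y ∈ Ioo (0:ℝ) 1 → 1 - J x y = J y x :=
    fun hx hy => by linarith [hJ.2.2.1 _ hx _ hy]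
  have hleft : ∀ a ∈ Ioo (0:ℝ) 1, ∀ b ∈ Ioo (0:ℝ) 1, ∀ c ∈ Ioo (0:ℝ) 1,
      m (m a b) c = J c (J (1 - b) a) := fun a ha b hb c hc => by
    rw [hm, hm, hJ.eq_one_sub_one_sub (hJ.1 a ha _ (hsub hb)) (hsub hc), sub_sub_cancel,
      hcompl ha (hsub hb)]
  have hright : ∀ a ∈ Ioo (0:ℝ) 1, ∀ b ∈ Ioo (0:ℝ) 1, ∀ c ∈ Ioo (0:ℝ) 1,
      m a (m b c) = J a (J (1 - b) c) := fun a ha b hb c hc => by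
    rw [hm, hm, hcompl hb (hsub hc), hJ.eq_one_sub_one_sub (hsub hc) hb, sub_sub_cancel]
  constructor
  · intro h a ha b hb c hc
    have := h a ha (1 - b) (hsub hb) c hc
    rwa [hleft a ha _ (hsub hb) c hc, hright a ha _ (hsub hb) c hc, sub_sub_cancel] at this
  · intro h a ha b hb c hc
    rw [hleft a ha b hb c hc, hright a ha b hb c hc]
    exact h a ha _ (hsub hb) c hc
end

section
/- Let ∗ : ℝ × ℝ → ℝ be a binary operation which is commutative, satisfies x ∗ 0 = x for all x ∈ ℝ, satisfies x ∗ (−x) = 0 for all x ∈ ℝ, has the inverse property (x ∗ t) ∗ (−t) = x for all x, t ∈ ℝ, is not associative (there exist x, y, z ∈ ℝ with (x ∗ y) ∗ z ≠ x ∗ (y ∗ z)), and is such that for each fixed t ∈ ℝ the map x ↦ x ∗ t is strictly increasing. Let f : (0,1) → ℝ be a strictly increasing homeomorphism with f(1−x) = −f(x) for every x ∈ (0,1). Then the operation · on (0,1) defined by a · b = f⁻¹(f(a) ∗ f(b)) satisfies: (1) · is commutative; (2) a · (1/2) = a for every a ∈ (0,1); (3) a · (1−a) = 1/2 for every a ∈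 (0,1); (4) a · (b · (1−a)) = b for every a, b ∈ (0,1); (5) for each fixed b₀ ∈ (0,1) the map a ↦ a · b₀ is strictly increasing; and (6) · is not associative. -/
open Set

/-- transferring a Salzmann-type loop from `ℝ` to `(0,1)` via a
strictly increasing homeomorphism `f` with `f (1 - x) = - f x` yields a proper
Jamesian loop `a * b = f⁻¹ (f a * f b)`. -/
theorem stmt_16 (star : ℝ → ℝ → ℝ)
    (hcomm : ∀ x y : ℝ, star x y = star y x)
    (hid : ∀ x : ℝ, star x 0 = x)
    (hinv : ∀ x : ℝ, star x (-x) = 0)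
    (hIP : ∀ x t : ℝ, star (star x t) (-t) = x)
    (hnassoc : ∃ x y z : ℝ, star (star x y) z ≠ star x (star y z))
    (hmono : ∀ t : ℝ, StrictMono (fun x => star x t))
    (f g : ℝ → ℝ)
    (hf_cont : ContinuousOn f (Ioo 0 1))
    (hf_mono : StrictMonoOn f (Ioo 0 1))
    (hg_cont : Continuous g)
    (hg_mem : ∀ y : ℝ, g y ∈ Ioo (0:ℝ) 1)
    (hgf : ∀ x ∈ Ioo (0:ℝ) 1, g (f x) = x)
    (hfg : ∀ y : ℝ, f (g y) = y)
    (hsym : ∀ x ∈ Ioo (0:ℝ) 1, f (1 - x) = - f x)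
    (m : ℝ → ℝ → ℝ) (hm : ∀ a b : ℝ, m a b = g (star (f a) (f b))) :
    (∀ a ∈ Ioo (0:ℝ) 1, ∀ b ∈ Ioo (0:ℝ) 1, m a b = m b a) ∧
    (∀ a ∈ Ioo (0:ℝ) 1, m a (1 / 2) = a) ∧
    (∀ a ∈ Ioo (0:ℝ) 1, m a (1 - a) = 1 / 2) ∧
    (∀ a ∈ Ioo (0:ℝ) 1, ∀ b ∈ Ioo (0:ℝ) 1, m a (m b (1 - a)) = b) ∧
    (∀ b₀ ∈ Ioo (0:ℝ) 1, StrictMonoOn (fun a => m a b₀) (Ioo 0 1)) ∧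
    (∃ a ∈ Ioo (0:ℝ) 1, ∃ b ∈ Ioo (0:ℝ) 1, ∃ c ∈ Ioo (0:ℝ) 1,
      m (m a b) c ≠ m a (m b c)) := by
  have hhalf_mem : (1 / 2 : ℝ) ∈ Ioo (0:ℝ) 1 := by constructor <;> norm_num
  have hhalf : f (1 / 2) = 0 := by
    have h := hsym _ hhalf_mem
    rw [show (1 - 1 / 2 : ℝ) = 1 / 2 by norm_num] at h
    linarith
  have hg_mono : StrictMono g := fun x y hxy => by
    rwa [← hf_mono.lt_iff_lt (hg_mem x) (hg_mem y), hfg, hfg]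
  refine ⟨fun a _ b _ => ?_, fun a ha => ?_, fun a ha => ?_, fun a ha b hb => ?_,
    fun b₀ _ a ha a' ha' h => ?_, ?_⟩
  · rw [hm, hm, hcomm]
  · rw [hm, hhalf, hid, hgf a ha]
  · rw [hm, hsym a ha, hinv, ← hhalf, hgf _ hhalf_mem]
  · have h := hIP (f b) (-f a)
    rw [neg_neg] at h
    rw [hm, hm, hfg, hsym a ha, hcomm, h, hgf b hb]
  · simp only [hm]
    exact hg_mono (hmono _ (hf_mono ha ha' h))
  · obtain ⟨x, y, z, h⟩ := hnassoc
    refine ⟨g x, hg_mem x, g y, hg_mem y, g z, hg_mem z, ?_⟩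
    simp only [hm, hfg]
    exact hg_mono.injective.ne h
end

section
/- Let J be an involutive Jamesian function which is not transitive (there exist a, b, c ∈ (0,1) with J(J(a,c), J(b,c)) ≠ J(a,b)). Then J cannot be approximated in the supremum norm by transitive involutive Jamesian functions: there exists ε > 0 such that for every transitive involutive Jamesian function H, sup over (a,b) ∈ (0,1) × (0,1) of |J(a,b) − H(a,b)| ≥ ε. -/
open Set

namespace IsJamesian

variable {J : ℝ → ℝ → ℝ}

theorem strictAntiOn_right (hJ : IsJamesian J) {a : ℝ} (ha : a ∈ Ioo (0:ℝ) 1) :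
    StrictAntiOn (J a) (Ioo 0 1) := by
  obtain ⟨-, -, hsum, hmono⟩ := hJ
  intro s hs t ht hst
  have h : J s a < J t a := hmono a ha hs ht hst
  linarith [hsum a ha s hs, hsum a ha t ht]

theorem exists_left_eq (hJ : IsJamesian J) {b v : ℝ} (hb : b ∈ Ioo (0:ℝ) 1)
    (hv : v ∈ Ioo (0:ℝ) 1) : ∃ a ∈ Ioo (0:ℝ) 1, J a b = v := by
  obtain ⟨hmap, hinv, hsum, -⟩ := hJ
  have hv' : 1 - v ∈ Ioo (0:ℝ) 1 := ⟨by linarith [hv.2], by linarith [hv.1]⟩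
  have hmem := hmap b hb _ hv'
  refine ⟨J b (1 - v), hmem, ?_⟩
  linarith [hinv b hb _ hv', hsum b hb _ hmem]

theorem exists_forall_lt_add (hJ : IsJamesian J) {x y δ : ℝ} (hx : x ∈ Ioo (0:ℝ) 1)
    (hy : y ∈ Ioo (0:ℝ) 1) (hδ : 0 < δ) :
    ∃ η > 0, ∀ s ∈ Ioo (0:ℝ) 1, ∀ t ∈ Ioo (0:ℝ) 1, s < x + η → y - η < t →
      J s t < J x y + δ := by
  have hxy := hJ.1 x hx y hy
  obtain ⟨w, hw, hw'⟩ := exists_between (lt_min hxy.2 (lt_add_of_pos_right (J x y) hδ))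
  obtain ⟨hw1, hwδ⟩ := lt_min_iff.1 hw'
  obtain ⟨u, hu, huw⟩ := exists_between hw
  obtain ⟨x', hx', hxu⟩ := hJ.exists_left_eq hy ⟨hxy.1.trans hu, huw.trans hw1⟩
  have hwm : w ∈ Ioo (0:ℝ) 1 := ⟨hxy.1.trans hw, hw1⟩
  have hy' := hJ.1 x' hx' w hwm
  have hyw : J x' (J x' w) = w := hJ.2.1 x' hx' w hwm
  have hxx' : x < x' := ((hJ.2.2.2 y hy).lt_iff_lt hx hx').1 (by simpa only [hxu] using hu)
  have hyy' : J x' w < y :=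
    ((hJ.strictAntiOn_right hx').lt_iff_gt hy hy').1 (by rwa [hxu, hyw])
  refine ⟨min (x' - x) (y - J x' w), lt_min (by linarith) (by linarith), ?_⟩
  intro s hs t ht hsx hty
  have hs' : s < x' := by linarith [min_le_left (x' - x) (y - J x' w)]
  have ht' : J x' w < t := by linarith [min_le_right (x' - x) (y - J x' w)]
  have h1 : J s t < J x' t := hJ.2.2.2 t ht hs hx' hs'
  have h2 := hJ.strictAntiOn_right hx' hy' ht ht'
  linarith

/-- Joint continuity of a Jamesian function on the open unit square. -/
theorem exists_forall_abs_sub_lt (hJ : IsJamesian J) {x y δ : ℝ} (hx : x ∈ Ioo (0:ℝ) 1)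
    (hy : y ∈ Ioo (0:ℝ) 1) (hδ : 0 < δ) :
    ∃ η > 0, ∀ s ∈ Ioo (0:ℝ) 1, ∀ t ∈ Ioo (0:ℝ) 1, |x - s| < η → |y - t| < η →
      |J x y - J s t| < δ := by
  obtain ⟨η₁, hη₁, h₁⟩ := hJ.exists_forall_lt_add hx hy hδ
  obtain ⟨η₂, hη₂, h₂⟩ := hJ.exists_forall_lt_add hy hx hδ
  refine ⟨min η₁ η₂, lt_min hη₁ hη₂, fun s hs t ht hxs hyt => ?_⟩
  rw [lt_min_iff, abs_lt, abs_lt] at hxs hyt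
  have hlt := h₁ s hs t ht (by linarith) (by linarith)
  have hgt := h₂ t ht s hs (by linarith) (by linarith)
  rw [abs_lt]
  constructor <;> linarith [hJ.2.2.1 x hx y hy, hJ.2.2.1 s hs t ht]

theorem abs_sub_le_sSup {H : ℝ → ℝ → ℝ} (hJ : IsJamesian J) (hH : IsJamesian H) {a b : ℝ}
    (ha : a ∈ Ioo (0:ℝ) 1) (hb : b ∈ Ioo (0:ℝ) 1) :
    |J a b - H a b| ≤ sSup ((fun p : ℝ × ℝ => |J p.1 p.2 - H p.1 p.2|) ''
      (Ioo 0 1 ×ˢ Ioo 0 1)) := by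
  refine le_csSup ⟨1, ?_⟩ ⟨(a, b), ⟨ha, hb⟩, rfl⟩
  rintro _ ⟨⟨s, t⟩, ⟨hs, ht⟩, rfl⟩
  have h1 := hJ.1 s hs t ht
  have h2 := hH.1 s hs t ht
  exact abs_le.2 ⟨by linarith [h1.1, h2.2], by linarith [h1.2, h2.1]⟩

end IsJamesian

/-- a non-transitive involutive Jamesian function cannot be
approximated in the supremum norm by transitive involutive Jamesian
functions. -/
theorem stmt_18 (J : ℝ → ℝ → ℝ) (hJ : IsJamesian J)
    (hnt : ∃ a ∈ Ioo (0:ℝ) 1, ∃ b ∈ Ioo (0:ℝ) 1, ∃ c ∈ Ioo (0:ℝ) 1,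
      J (J a c) (J b c) ≠ J a b) :
    ∃ ε > (0:ℝ), ∀ H : ℝ → ℝ → ℝ, IsJamesian H → IsTransitive H →
      ε ≤ sSup ((fun p : ℝ × ℝ => |J p.1 p.2 - H p.1 p.2|) ''
        (Ioo 0 1 ×ˢ Ioo 0 1)) := by
  obtain ⟨a, ha, b, hb, c, hc, hne⟩ := hnt
  have hD : 0 < |J (J a c) (J b c) - J a b| / 3 := by
    have := abs_pos.2 (sub_ne_zero.2 hne)
    positivity
  obtain ⟨η, hη, hcont⟩ :=
    hJ.exists_forall_abs_sub_lt (hJ.1 a ha c hc) (hJ.1 b hb c hc) hD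
  refine ⟨min η (|J (J a c) (J b c) - J a b| / 3), lt_min hη hD, fun H hH hT => ?_⟩
  by_contra! hlt
  have hclose : ∀ s ∈ Ioo (0:ℝ) 1, ∀ t ∈ Ioo (0:ℝ) 1,
      |J s t - H s t| < η ∧ |J s t - H s t| < |J (J a c) (J b c) - J a b| / 3 :=
    fun s hs t ht => lt_min_iff.1 ((hJ.abs_sub_le_sSup hH hs ht).trans_lt hlt)
  have hs := hH.1 a ha c hc
  have ht := hH.1 b hb c hc
  have h1 := hcont _ hs _ ht (hclose a ha c hc).1 (hclose b hb c hc).1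
  have h2 := (hclose _ hs _ ht).2
  have h3 := (hclose a ha b hb).2
  rw [hT a ha b hb c hc] at h2
  rw [abs_sub_comm] at h3
  have h4 := abs_sub_le (J (J a c) (J b c)) (J (H a c) (H b c)) (J a b)
  have h5 := abs_sub_le (J (H a c) (H b c)) (H a b) (J a b)
  linarith
end
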